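/- Suppose the limit L = lim_{n→∞} (M_n)^{1/n} exists. Then limsup_{n→∞} (M^{(P)}_n)^{1/n} = L, i.e. open meanders and prime open meanders have the same exponential growth rate. -/

import Mathlib

open Filter

/-- `x` lies strictly between `p` and `q`. -/
def StrictlyBetween (p q x : ℕ) : Prop := min p q < x ∧ x < max p q

/-- Two arcs `{p, q}` and `{r, s}` cross if exactly one of `r`, `s` lies strictly
between `p` and `q`. -/
def ArcsCross (p q r s : ℕ) : Prop :=
  Xor' (StrictlyBetween p q r) (StrictlyBetween p q s)

/-- `a` (with one-based indexing, only the values `a 1, …, a n` being relevant)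
is an open meandric permutation of order `n`: it is a permutation of `{1, …, n}`
with `a i ≡ i (mod 2)`, whose upper arcs (pairs `{a i, a (i+1)}` for odd `i < n`)
are pairwise noncrossing, whose lower arcs (pairs `{a i, a (i+1)}` for even
`1 ≤ i < n`) are pairwise noncrossing, such that no lower arc strictly encloses
`a 1`, and no lower arc (if `n` is even) resp. upper arc (if `n` is odd)
strictly encloses `a n`. -/
def IsOpenMeandricPerm (n : ℕ) (a : ℕ → ℕ) : Prop :=
  1 ≤ n ∧
  (∀ i, 1 ≤ i → i ≤ n → 1 ≤ a i ∧ a i ≤ n) ∧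
  (∀ i j, 1 ≤ i → i ≤ n → 1 ≤ j → j ≤ n → a i = a j → i = j) ∧
  (∀ i, 1 ≤ i → i ≤ n → a i % 2 = i % 2) ∧
  (∀ i j, Odd i → i < n → Odd j → j < n →
      ¬ ArcsCross (a i) (a (i + 1)) (a j) (a (j + 1))) ∧
  (∀ i j, Even i → 1 ≤ i → i < n → Even j → 1 ≤ j → j < n →
      ¬ ArcsCross (a i) (a (i + 1)) (a j) (a (j + 1))) ∧
  (∀ i, Even i → 1 ≤ i → i < n → ¬ StrictlyBetween (a i) (a (i + 1)) (a 1)) ∧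
  (if Even n
    then ∀ i, Even i → 1 ≤ i → i < n → ¬ StrictlyBetween (a i) (a (i + 1)) (a n)
    else ∀ i, Odd i → i < n → ¬ StrictlyBetween (a i) (a (i + 1)) (a n))

/-- An open meandric permutation of order `n` is irreducible if there are no
indices `1 ≤ k₁ < k₂ ≤ n` with `2 < k₂ - k₁ ≤ n - 2` such that the values
`a k₁, …, a k₂` form an interval of integers, i.e. their max minus their min
equals `k₂ - k₁`. -/
def IsIrreducibleMeander (n : ℕ) (a : ℕ → ℕ) : Prop :=
  ¬ ∃ k₁ k₂ : ℕ, ∃ h : k₁ < k₂, 1 ≤ k₁ ∧ k₂ ≤ n ∧ 2 < k₂ - k₁ ∧ k₂ - k₁ ≤ n - 2 ∧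
    (Finset.Icc k₁ k₂).sup' (Finset.nonempty_Icc.mpr h.le) a -
      (Finset.Icc k₁ k₂).inf' (Finset.nonempty_Icc.mpr h.le) a = k₂ - k₁

/-- An open meandric permutation of order `n` is prime if `a 1 ≠ 1` and no proper
initial segment `a 1, …, a j` (`2 ≤ j < n`) is a permutation of `{1, …, j}`. -/
def IsPrimeMeander (n : ℕ) (a : ℕ → ℕ) : Prop :=
  a 1 ≠ 1 ∧ ¬ ∃ j, 2 ≤ j ∧ j < n ∧ (Finset.Icc 1 j).image a = Finset.Icc 1 j

/-- `a` (with one-based indexing) is a closed meandric permutation of order `n`: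
a permutation of `{1, …, 2n}` with `a 1 = 1`, `a i ≡ i (mod 2)`, pairwise
noncrossing upper arcs `{a i, a (i+1)}` (odd `i < 2n`) and pairwise noncrossing
lower arcs, the latter being the `{a i, a (i+1)}` for even `1 ≤ i < 2n` together
with the wrap-around arc `{a (2n), a 1}`. -/
def IsClosedMeandricPerm (n : ℕ) (a : ℕ → ℕ) : Prop :=
  1 ≤ n ∧ a 1 = 1 ∧
  (∀ i, 1 ≤ i → i ≤ 2 * n → 1 ≤ a i ∧ a i ≤ 2 * n) ∧
  (∀ i j, 1 ≤ i → i ≤ 2 * n → 1 ≤ j → j ≤ 2 * n → a i = a j → i = j) ∧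
  (∀ i, 1 ≤ i → i ≤ 2 * n → a i % 2 = i % 2) ∧
  (∀ i j, Odd i → i < 2 * n → Odd j → j < 2 * n →
      ¬ ArcsCross (a i) (a (i + 1)) (a j) (a (j + 1))) ∧
  (∀ i j, Even i → 1 ≤ i → i < 2 * n → Even j → 1 ≤ j → j < 2 * n →
      ¬ ArcsCross (a i) (a (i + 1)) (a j) (a (j + 1))) ∧
  (∀ i, Even i → 1 ≤ i → i < 2 * n →
      ¬ ArcsCross (a i) (a (i + 1)) (a (2 * n)) (a 1) ∧
      ¬ ArcsCross (a (2 * n)) (a 1) (a i) (a (i + 1)))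

/-- `M n`: the number of open meandric permutations of order `n` (each counted
once via the normalization `a i = 0` outside `{1, …, n}`). -/
noncomputable def openMeanderCount (n : ℕ) : ℕ :=
  Set.ncard {a : ℕ → ℕ | IsOpenMeandricPerm n a ∧ ∀ i, i < 1 ∨ n < i → a i = 0}

/-- `M^{Irr} n`: the number of irreducible open meandric permutations of order `n`. -/
noncomputable def irrMeanderCount (n : ℕ) : ℕ :=
  Set.ncard {a : ℕ → ℕ | IsOpenMeandricPerm n a ∧ IsIrreducibleMeander n a ∧
    ∀ i, i < 1 ∨ n < i → a i = 0}

/-- `M^{(P)} n`: the number of prime open meandric permutations of order `n`. -/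
noncomputable def primeMeanderCount (n : ℕ) : ℕ :=
  Set.ncard {a : ℕ → ℕ | IsOpenMeandricPerm n a ∧ IsPrimeMeander n a ∧
    ∀ i, i < 1 ∨ n < i → a i = 0}

/-- `M̄ n`: the number of closed meandric permutations of order `n`. -/
noncomputable def closedMeanderCount (n : ℕ) : ℕ :=
  Set.ncard {a : ℕ → ℕ | IsClosedMeandricPerm n a ∧ ∀ i, i < 1 ∨ 2 * n < i → a i = 0}

/-- The normalized sequence obtained from an open meander of odd order `n` by winding each of its
two ends once around the whole picture:
`(n + 4, 2, a 1 + 2, …, a n + 2, n + 3, 1)`. -/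
def spiralExtension (n : ℕ) (a : ℕ → ℕ) (i : ℕ) : ℕ :=
  if i = 1 then n + 4
  else if i = 2 then 2
  else if i < 3 then 0
  else if i ≤ n + 2 then a (i - 2) + 2
  else if i = n + 3 then n + 3
  else if i = n + 4 then 1
  else 0

section spiralExtension

variable (n : ℕ) (a : ℕ → ℕ)

lemma spiralExtension_one : spiralExtension n a 1 = n + 4 := by
  simp [spiralExtension]

lemma spiralExtension_two : spiralExtension n a 2 = 2 := by
  simp [spiralExtension]

lemma spiralExtension_add_two {k : ℕ} (h1 : 1 ≤ k) (hn : k ≤ n) :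
    spiralExtension n a (k + 2) = a k + 2 := by
  unfold spiralExtension
  split_ifs <;> first | omega | simp

lemma spiralExtension_add_three (hn : 1 ≤ n) : spiralExtension n a (n + 3) = n + 3 := by
  unfold spiralExtension
  split_ifs <;> omega

lemma spiralExtension_add_four : spiralExtension n a (n + 4) = 1 := by
  unfold spiralExtension
  split_ifs <;> omega

lemma spiralExtension_eq_zero {i : ℕ} (h : i < 1 ∨ n + 4 < i) : spiralExtension n a i = 0 := by
  unfold spiralExtension
  split_ifs <;> omega

/-- The indices of a spiral extension, split into the four new ones and the shifted old ones. -/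
lemma spiralExtension_index_cases {n i : ℕ} (h1 : 1 ≤ i) (hn : i ≤ n + 4) :
    i = 1 ∨ i = 2 ∨ (∃ k, 1 ≤ k ∧ k ≤ n ∧ i = k + 2) ∨ i = n + 3 ∨ i = n + 4 := by
  by_cases h : 3 ≤ i ∧ i ≤ n + 2
  · exact Or.inr (Or.inr (Or.inl ⟨i - 2, by omega, by omega, by omega⟩))
  · omega

end spiralExtension

lemma not_arcsCross_iff (p q r s : ℕ) :
    ¬ ArcsCross p q r s ↔ (StrictlyBetween p q r ↔ StrictlyBetween p q s) :=
  not_xor _ _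

lemma isOpenMeandricPerm_spiralExtension {n : ℕ} {a : ℕ → ℕ} (hodd : Odd n)
    (ha : IsOpenMeandricPerm n a) : IsOpenMeandricPerm (n + 4) (spiralExtension n a) := by
  obtain ⟨hn, hrange, hinj, hpar, hup, hlow, hstart, hend⟩ := ha
  rw [if_neg (Nat.not_even_iff_odd.mpr hodd)] at hend
  simp only [not_arcsCross_iff, StrictlyBetween] at hup hlow hstart hend
  have e1 := spiralExtension_one n a
  have e2 := spiralExtension_two n a
  have em := fun k => spiralExtension_add_two n a (k := k)
  have e3 := spiralExtension_add_three n a hn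
  have e4 := spiralExtension_add_four n a
  have hodd' : n % 2 = 1 := Nat.odd_iff.mp hodd
  have hneven : ¬ Even (n + 4) := by rw [Nat.even_iff]; omega
  have upper : ∀ i, Odd i → i < n + 4 →
      (spiralExtension n a i = n + 4 ∧ spiralExtension n a (i + 1) = 2) ∨
      (∃ k, Odd k ∧ k < n ∧ spiralExtension n a i = a k + 2 ∧
        spiralExtension n a (i + 1) = a (k + 1) + 2) ∨
      (spiralExtension n a i = a n + 2 ∧
        spiralExtension n a (i + 1) = n + 3) := by
    intro i hi hin
    rw [Nat.odd_iff] at hi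
    rcases spiralExtension_index_cases (by omega) hin.le with
      rfl | rfl | ⟨k, hk1, hkn, rfl⟩ | rfl | rfl
    · exact Or.inl ⟨e1, e2⟩
    · omega
    · rcases hkn.eq_or_lt with rfl | hkn
      · exact Or.inr (Or.inr ⟨em k hk1 le_rfl, e3⟩)
      · exact Or.inr (Or.inl ⟨k, Nat.odd_iff.mpr (by omega), hkn, em k hk1 hkn.le,
          em (k + 1) (by omega) (by omega)⟩)
    · omega
    · omega
  have lower : ∀ i, Even i → 1 ≤ i → i < n + 4 →
      (spiralExtension n a i = 2 ∧ spiralExtension n a (i + 1) = a 1 + 2) ∨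
      (∃ k, Even k ∧ 1 ≤ k ∧ k < n ∧ spiralExtension n a i = a k + 2 ∧
        spiralExtension n a (i + 1) = a (k + 1) + 2) ∨
      (spiralExtension n a i = n + 3 ∧
        spiralExtension n a (i + 1) = 1) := by
    intro i hi h1 hin
    rw [Nat.even_iff] at hi
    rcases spiralExtension_index_cases h1 hin.le with
      rfl | rfl | ⟨k, hk1, hkn, rfl⟩ | rfl | rfl
    · omega
    · exact Or.inl ⟨e2, em 1 le_rfl hn⟩
    · rcases hkn.eq_or_lt with rfl | hkn
      · omega
      · exact Or.inr (Or.inl ⟨k, Nat.even_iff.mpr (by omega), hk1, hkn, em k hk1 hkn.le,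
          em (k + 1) (by omega) (by omega)⟩)
    · exact Or.inr (Or.inr ⟨e3, e4⟩)
    · omega
  have hr1 := hrange 1 le_rfl hn
  have hrn := hrange n hn le_rfl
  refine ⟨by omega, ?_, ?_, ?_, ?_, ?_, ?_, ?_⟩
  · intro i hi hin
    rcases spiralExtension_index_cases hi hin with rfl | rfl | ⟨k, hk1, hkn, rfl⟩ | rfl | rfl
    · omega
    · omega
    · have := hrange k hk1 hkn
      rw [em k hk1 hkn]
      omega
    · omega
    · omega
  · intro i j hi hin hj hjn hij
    rcases spiralExtension_index_cases hi hin with rfl | rfl | ⟨k, hk1, hkn, rfl⟩ | rfl | rfl <;>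
    rcases spiralExtension_index_cases hj hjn with rfl | rfl | ⟨l, hl1, hln, rfl⟩ | rfl | rfl <;>
    first
    | omega
    | (have := hrange k hk1 hkn
       rw [em k hk1 hkn] at hij
       omega)
    | (have := hrange l hl1 hln
       rw [em l hl1 hln] at hij
       omega)
    | (rw [em k hk1 hkn, em l hl1 hln] at hij
       rw [hinj k l hk1 hkn hl1 hln (by omega)])
  · intro i hi hin
    rcases spiralExtension_index_cases hi hin with rfl | rfl | ⟨k, hk1, hkn, rfl⟩ | rfl | rfl
    · omega
    · omega
    · have := hpar k hk1 hkn
      rw [em k hk1 hkn]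
      omega
    · omega
    · omega
  · intro i j hi hin hj hjn
    have old : ∀ k, Odd k → k < n → (1 ≤ a k ∧ a k ≤ n) ∧ (1 ≤ a (k + 1) ∧ a (k + 1) ≤ n) ∧
        a k ≠ a n ∧ a (k + 1) ≠ a n := by
      intro k hk hkn
      rw [Nat.odd_iff] at hk
      exact ⟨hrange k (by omega) hkn.le, hrange (k + 1) (by omega) hkn,
        fun h' => by have := hinj k n (by omega) hkn.le hn le_rfl h'; omega,
        fun h' => by have := hinj (k + 1) n (by omega) hkn hn le_rfl h'; omega⟩
    rcases upper i hi hin with ⟨h1, h2⟩ | ⟨k, hk, hkn, h1, h2⟩ | ⟨h1, h2⟩ <;>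
    rcases upper j hj hjn with ⟨h3, h4⟩ | ⟨l, hl, hln, h3, h4⟩ | ⟨h3, h4⟩ <;>
    rw [h1, h2, h3, h4, not_arcsCross_iff] <;>
    (try have hok := old k hk hkn) <;> (try have hek := hend k hk hkn) <;>
    (try have hol := old l hl hln) <;> (try have hel := hend l hl hln) <;>
    (try have hkl := hup k l hk hkn hl hln) <;>
    simp only [StrictlyBetween] <;> omega
  · intro i j hi hi1 hin hj hj1 hjn
    have old : ∀ k, Even k → 1 ≤ k → k < n → (1 ≤ a k ∧ a k ≤ n) ∧
        (1 ≤ a (k + 1) ∧ a (k + 1) ≤ n) ∧ a k ≠ a 1 ∧ a (k + 1) ≠ a 1 := by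
      intro k hk hk1 hkn
      rw [Nat.even_iff] at hk
      exact ⟨hrange k hk1 hkn.le, hrange (k + 1) (by omega) hkn,
        fun h' => by have := hinj k 1 hk1 hkn.le le_rfl hn h'; omega,
        fun h' => by have := hinj (k + 1) 1 (by omega) hkn le_rfl hn h'; omega⟩
    rcases lower i hi hi1 hin with ⟨h1, h2⟩ | ⟨k, hk, hk1, hkn, h1, h2⟩ | ⟨h1, h2⟩ <;>
    rcases lower j hj hj1 hjn with ⟨h3, h4⟩ | ⟨l, hl, hl1, hln, h3, h4⟩ | ⟨h3, h4⟩ <;>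
    rw [h1, h2, h3, h4, not_arcsCross_iff] <;>
    (try have hok := old k hk hk1 hkn) <;> (try have hek := hstart k hk hk1 hkn) <;>
    (try have hol := old l hl hl1 hln) <;> (try have hel := hstart l hl hl1 hln) <;>
    (try have hkl := hlow k l hk hk1 hkn hl hl1 hln) <;>
    simp only [StrictlyBetween] <;> omega
  · intro i hi hi1 hin
    rcases lower i hi hi1 hin with ⟨h1, h2⟩ | ⟨k, hk, hk1, hkn, h1, h2⟩ | ⟨h1, h2⟩
    · rw [h1, h2, e1]; simp only [StrictlyBetween]; omega
    · have := hrange k hk1 hkn.le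
      have := hrange (k + 1) (by omega) hkn
      rw [h1, h2, e1]; simp only [StrictlyBetween]; omega
    · rw [h1, h2, e1]; simp only [StrictlyBetween]; omega
  · rw [if_neg hneven]
    intro i hi hin
    rw [e4]
    rcases upper i hi hin with ⟨h1, h2⟩ | ⟨k, hk, hkn, h1, h2⟩ | ⟨h1, h2⟩ <;>
    rw [h1, h2] <;> simp only [StrictlyBetween] <;> omega

lemma isPrimeMeander_of_first_eq {n : ℕ} {a : ℕ → ℕ} (hn : 2 ≤ n) (ha : a 1 = n) :
    IsPrimeMeander n a := by
  refine ⟨by omega, ?_⟩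
  rintro ⟨j, hj, hjn, h⟩
  have : a 1 ∈ Finset.Icc 1 j :=
    h ▸ Finset.mem_image_of_mem a (Finset.mem_Icc.mpr ⟨le_rfl, by omega⟩)
  rw [Finset.mem_Icc] at this
  omega

lemma finite_setOf_isOpenMeandricPerm (n : ℕ) :
    {a : ℕ → ℕ | IsOpenMeandricPerm n a ∧ ∀ i, i < 1 ∨ n < i → a i = 0}.Finite := by
  refine Set.Finite.of_injOn (f := fun a (i : Fin (n + 1)) => a i)
    (t := Set.univ.pi fun _ => Set.Iic n) ?_ ?_ (Set.Finite.pi fun _ => Set.finite_Iic n)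
  · rintro a ⟨ha, h0⟩ i -
    change a i ≤ n
    by_cases hi : (i : ℕ) < 1
    · simp [h0 i (Or.inl hi)]
    · exact (ha.2.1 i (by omega) (by omega)).2
  · rintro a ⟨-, ha⟩ b ⟨-, hb⟩ hab
    funext i
    by_cases hi : n < i
    · rw [ha i (Or.inr hi), hb i (Or.inr hi)]
    · exact congrFun hab ⟨i, by omega⟩

lemma primeMeanderCount_le_openMeanderCount (n : ℕ) :
    primeMeanderCount n ≤ openMeanderCount n :=
  Set.ncard_le_ncard (fun _ h => ⟨h.1, h.2.2⟩) (finite_setOf_isOpenMeandricPerm n)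

lemma openMeanderCount_le_primeMeanderCount_add_four {n : ℕ} (hn : Odd n) :
    openMeanderCount n ≤ primeMeanderCount (n + 4) := by
  refine Set.ncard_le_ncard_of_injOn (spiralExtension n) ?_ ?_
    ((finite_setOf_isOpenMeandricPerm (n + 4)).subset fun _ h => ⟨h.1, h.2.2⟩)
  · rintro a ⟨ha, -⟩
    exact ⟨isOpenMeandricPerm_spiralExtension hn ha,
      isPrimeMeander_of_first_eq (by omega) (spiralExtension_one n a),
      fun i => spiralExtension_eq_zero n a⟩
  · rintro a ⟨-, ha⟩ b ⟨-, hb⟩ hab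
    funext i
    by_cases hi : i < 1 ∨ n < i
    · rw [ha i hi, hb i hi]
    · have := congrFun hab (i + 2)
      rw [spiralExtension_add_two n a (by omega) (by omega),
        spiralExtension_add_two n b (by omega) (by omega)] at this
      omega

/-- Shifting the root taken by a constant does not change an exponential growth rate. -/
lemma tendsto_rpow_one_div_add_four {f : ℕ → ℝ} (hf : ∀ n, 0 ≤ f n) {L : ℝ}
    (h : Tendsto (fun n : ℕ => f n ^ (1 / (n : ℝ))) atTop (nhds L)) :
    Tendsto (fun n : ℕ => f n ^ (1 / ((n + 4 : ℕ) : ℝ))) atTop (nhds L) := by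
  have hexp : Tendsto (fun n : ℕ => (n : ℝ) / ((n : ℝ) + 4)) atTop (nhds 1) :=
    tendsto_natCast_div_add_atTop 4
  have hpow := h.rpow hexp (Or.inr one_pos)
  rw [Real.rpow_one] at hpow
  refine hpow.congr' ?_
  filter_upwards [eventually_ge_atTop 1] with n hn
  rw [← Real.rpow_mul (hf n)]
  congr 1
  have : (n : ℝ) ≠ 0 := Nat.cast_ne_zero.mpr (by omega)
  push_cast
  field_simp

/-- If `L = lim (M n)^(1/n)` exists, then
`limsup (M^{(P)} n)^(1/n) = L`: open meanders and prime open meanders have the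
same exponential growth rate. -/
theorem prime_meander_growth_eq (L : ℝ)
    (hL : Tendsto (fun n : ℕ => (openMeanderCount n : ℝ) ^ (1 / (n : ℝ))) atTop (nhds L)) :
    limsup (fun n : ℕ => (primeMeanderCount n : ℝ) ^ (1 / (n : ℝ))) atTop = L := by
  have hle : (fun n : ℕ => (primeMeanderCount n : ℝ) ^ (1 / (n : ℝ))) ≤
      fun n : ℕ => (openMeanderCount n : ℝ) ^ (1 / (n : ℝ)) := fun n =>
    Real.rpow_le_rpow (by positivity)
      (mod_cast primeMeanderCount_le_openMeanderCount n) (by positivity)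
  have hbdd := hL.isBoundedUnder_le.mono_le (Eventually.of_forall hle)
  have hcobdd : IsCoboundedUnder (· ≤ ·) atTop
      (fun n : ℕ => (primeMeanderCount n : ℝ) ^ (1 / (n : ℝ))) :=
    IsBoundedUnder.isCoboundedUnder_le (isBoundedUnder_of ⟨0, fun n => Real.rpow_nonneg (Nat.cast_nonneg _) _⟩)
  refine le_antisymm ?_ (le_of_forall_lt fun c hc => ?_)
  · exact hL.limsup_eq ▸ limsup_le_limsup (Eventually.of_forall hle) hcobdd hL.isBoundedUnder_le
  · obtain ⟨d, hcd, hdL⟩ := exists_between hc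
    refine hcd.trans_le (le_limsup_of_frequently_le ?_ hbdd)
    obtain ⟨K, hK⟩ := eventually_atTop.mp
      ((tendsto_rpow_one_div_add_four (fun n => Nat.cast_nonneg (openMeanderCount n))
        hL).eventually_const_lt hdL)
    refine frequently_atTop.mpr fun m => ⟨2 * (m + K) + 1 + 4, by omega, ?_⟩
    refine (hK (2 * (m + K) + 1) (by omega)).le.trans (Real.rpow_le_rpow (by positivity) ?_
      (by positivity))
    exact_mod_cast openMeanderCount_le_primeMeanderCount_add_four (odd_two_mul_add_one _)
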